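/- arXiv:1012.4177 — 3 statements merged into one kernel-verified Lean document; each statement's English description precedes it below -/
import Mathlib

section
/- Let G be an abelian group of cardinality at most 2^𝔠 that is not bounded (i.e., for no positive integer n does n·G = {0}). Then G is isomorphic to a dense subgroup of T^𝔠, where T = ℝ/ℤ and 𝔠 is the cardinality of the continuum. Conversely, any dense subgroup of T^𝔠 is unbounded and has cardinality at most 2^𝔠. -/
open Cardinal

theorem exists_addCircle_extension {A B : Type*} [AddCommGroup A] [AddCommGroup B]
    (i : A →+ B) (χ : A →+ UnitAddCircle) (h : ∀ a, i a = 0 → χ a = 0) :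
    ∃ ψ : B →+ UnitAddCircle, ∀ a, ψ (i a) = χ a := by
  let j : A ⧸ i.ker →+ B := QuotientAddGroup.kerLift i
  let c : A ⧸ i.ker →+ UnitAddCircle := QuotientAddGroup.lift i.ker χ (fun a ha => h a ha)
  obtain ⟨ψ, hψ⟩ := (Module.Baer.of_divisible UnitAddCircle).extension_property_addMonoidHom j
    (QuotientAddGroup.kerLift_injective i) c
  exact ⟨ψ, fun a => DFunLike.congr_fun hψ (a : A ⧸ i.ker)⟩

theorem exists_addCircle_apply_eq {A : Type*} [AddCommGroup A] (x : A) (v : UnitAddCircle)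
    (h : addOrderOf x • v = 0) : ∃ χ : A →+ UnitAddCircle, χ x = v := by
  obtain ⟨ψ, hψ⟩ := exists_addCircle_extension (zmultiplesHom A x)
    (zmultiplesHom UnitAddCircle v) (fun n hn => by
      simp only [zmultiplesHom_apply] at hn ⊢
      rw [← addOrderOf_dvd_iff_zsmul_eq_zero] at hn
      obtain ⟨k, rfl⟩ := hn
      rw [mul_comm, mul_smul, natCast_zsmul, h, smul_zero])
  exact ⟨ψ, by simpa using hψ 1⟩

theorem exists_addCircle_apply_ne_zero {A : Type*} [AddCommGroup A] {x : A} (hx : x ≠ 0) :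
    ∃ χ : A →+ UnitAddCircle, χ x ≠ 0 := by
  have h1 : addOrderOf x ≠ 1 := by simpa using hx
  have key : ∃ v : UnitAddCircle, v ≠ 0 ∧ addOrderOf x • v = 0 := by
    rcases Nat.eq_zero_or_pos (addOrderOf x) with h0 | h0
    · have := AddCircle.addOrderOf_period_div (p := (1 : ℝ)) two_pos
      refine ⟨((1 / (2 : ℕ) : ℝ) : UnitAddCircle), fun h => ?_, by rw [h0, zero_smul]⟩
      rw [h, addOrderOf_zero] at this
      exact absurd this (by norm_num)
    · have := AddCircle.addOrderOf_period_div (p := (1 : ℝ)) h0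
      refine ⟨_, fun h => ?_, this ▸ addOrderOf_nsmul_eq_zero _⟩
      rw [h, addOrderOf_zero] at this
      exact h1 this.symm
  obtain ⟨v, hv, hxv⟩ := key
  obtain ⟨χ, hχ⟩ := exists_addCircle_apply_eq x v hxv
  exact ⟨χ, hχ ▸ hv⟩

theorem exists_linearIndependent_mkQ {M : Type*} [AddCommGroup M]
    {v : ℝ → M} (hv : LinearIndependent ℤ v) (N : Submodule ℤ M) [Countable N] :
    ∃ w : ℝ → M, LinearIndependent ℤ (fun t => N.mkQ (w t)) := by
  have h1 : 𝔠 ≤ Module.rank ℤ M := by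
    simpa only [mk_real, lift_continuum, lift_uzero] using hv.cardinal_lift_le_rank
  rw [← rank_quotient_add_rank_of_isDomain N] at h1
  have h2 : Module.rank ℤ N ≤ ℵ₀ := (rank_le_card ℤ N).trans (mk_le_aleph0)
  have h3 : 𝔠 ≤ Module.rank ℤ (M ⧸ N) := by
    by_contra! h
    exact (add_lt_of_lt aleph0_le_continuum h (h2.trans_lt aleph0_lt_continuum)).not_ge h1
  obtain ⟨s, hs, hli⟩ := exists_set_linearIndependent_of_isDomain ℤ (M ⧸ N)
  have h4 : Nonempty (ℝ ↪ s) := by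
    rw [← lift_mk_le']
    simpa only [hs, mk_real, lift_continuum, lift_uzero] using h3
  obtain ⟨e⟩ := h4
  choose g hg using N.mkQ_surjective
  refine ⟨fun t => g (e t), ?_⟩
  simp only [hg]
  exact LinearIndependent.comp hli e e.injective

theorem exists_linearIndependent_int_real : ∃ v : ℝ → ℝ, LinearIndependent ℤ v := by
  let b := Module.Basis.ofVectorSpace ℚ ℝ
  have h : #(Module.Basis.ofVectorSpaceIndex ℚ ℝ) = 𝔠 := by
    rw [← Real.rank_rat_real, b.mk_eq_rank'']
  obtain ⟨e⟩ : Nonempty (ℝ ≃ Module.Basis.ofVectorSpaceIndex ℚ ℝ) := by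
    rw [← Cardinal.eq, h, mk_real]
  exact ⟨_, ((b.linearIndependent.comp e e.injective).restrict_scalars (R := ℤ)
    (by intro a b h; simpa using h))⟩

theorem exists_linearIndependent_addCircle :
    ∃ v : ℝ → UnitAddCircle, LinearIndependent ℤ v := by
  obtain ⟨v, hv⟩ := exists_linearIndependent_int_real
  let N : Submodule ℤ ℝ := AddSubgroup.toIntSubmodule (AddSubgroup.zmultiples (1 : ℝ))
  have : Countable N := inferInstanceAs (Countable (AddSubgroup.zmultiples (1 : ℝ)))
  obtain ⟨w, hw⟩ := exists_linearIndependent_mkQ hv N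
  refine ⟨fun t => (w t : UnitAddCircle), ?_⟩
  rw [linearIndependent_iff'] at hw ⊢
  intro s g hg
  refine hw s g ?_
  have : ((∑ i ∈ s, g i • w i : ℝ) : UnitAddCircle) = 0 := by
    rw [← hg]
    exact map_sum (QuotientAddGroup.mk' (AddSubgroup.zmultiples (1 : ℝ))) _ _
  simp_rw [← map_smul]
  rw [← map_sum, Submodule.mkQ_apply, Submodule.Quotient.mk_eq_zero]
  exact (QuotientAddGroup.eq_zero_iff _).1 this

theorem mFourier_add_apply {F : Type*} [Fintype F] (n : F → ℤ) (x y : UnitAddTorus F) :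
    UnitAddTorus.mFourier n (x + y) = UnitAddTorus.mFourier n x * UnitAddTorus.mFourier n y := by
  simp [UnitAddTorus.mFourier, fourier_apply, smul_add, AddCircle.toCircle_add,
    Finset.prod_mul_distrib]

theorem mFourier_eq_toCircle {F : Type*} [Fintype F] (n : F → ℤ) (x : UnitAddTorus F) :
    UnitAddTorus.mFourier n x = ((∑ i, n i • x i : UnitAddCircle).toCircle : ℂ) := by
  classical
  have h : ∀ s : Finset F, ∏ i ∈ s, fourier (n i) (x i) =
      ((∑ i ∈ s, n i • x i : UnitAddCircle).toCircle : ℂ) := by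
    intro s
    induction s using Finset.induction_on with
    | empty => simp
    | insert a s ha ih =>
      rw [Finset.prod_insert ha, Finset.sum_insert ha, ih, AddCircle.toCircle_add, fourier_apply,
        Circle.coe_mul]
  exact h _

open MeasureTheory in
theorem dense_addSubgroup_of_forall_character {F : Type*} [Fintype F]
    (S : AddSubgroup (UnitAddTorus F))
    (h : ∀ n : F → ℤ, (∀ x ∈ S, ∑ i, n i • x i = 0) → n = 0) :
    Dense (S : Set (UnitAddTorus F)) := by
  let K := S.topologicalClosure
  have hKc : IsClosed (K : Set (UnitAddTorus F)) := S.isClosed_topologicalClosure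
  let : MeasurableSpace K := borel K
  have : BorelSpace K := ⟨rfl⟩
  have : CompactSpace K := isCompact_iff_compactSpace.1 hKc.isCompact
  let μ : Measure K := Measure.addHaar
  have hint : ∀ f : C(UnitAddTorus F, ℂ), ∀ x, Integrable (fun k : K => f (x + k)) μ := by
    intro f x
    have hc : Continuous (fun k : K => f (x + k)) := by fun_prop
    exact hc.integrable_of_hasCompactSupport (HasCompactSupport.of_compactSpace _)
  let L : UnitAddTorus F → C(UnitAddTorus F, ℂ) →ₗ[ℂ] ℂ := fun x =>
    { toFun := fun f => ∫ k : K, f (x + k) ∂μ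
      map_add' := fun f g => integral_add (hint f x) (hint g x)
      map_smul' := fun c f => integral_const_mul c _ }
  have hbound : ∀ x f, ‖L x f‖ ≤ μ.real Set.univ * ‖f‖ := by
    intro x f
    rw [mul_comm]
    exact norm_integral_le_of_norm_le_const
      (Filter.Eventually.of_forall fun k => f.norm_coe_le_norm _)
  have hchar : ∀ x n, L x (UnitAddTorus.mFourier n) = L 0 (UnitAddTorus.mFourier n) := by
    intro x n
    have hx : ∀ x, L x (UnitAddTorus.mFourier n) =
        UnitAddTorus.mFourier n x * ∫ k : K, UnitAddTorus.mFourier n (k : UnitAddTorus F) ∂μ := by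
      intro x
      rw [← integral_const_mul]
      exact integral_congr_ae (Filter.Eventually.of_forall fun k => mFourier_add_apply n x k)
    rw [hx, hx]
    by_cases hn : n = 0
    · subst hn
      simp [UnitAddTorus.mFourier_zero]
    · obtain ⟨s, hs, hns⟩ : ∃ s ∈ S, ∑ i, n i • s i ≠ 0 := by
        by_contra! hcon
        exact hn (h n hcon)
      have hsK : s ∈ K := S.le_topologicalClosure hs
      have h1 : UnitAddTorus.mFourier n s ≠ 1 := by
        rw [mFourier_eq_toCircle]
        intro h1
        apply hns
        apply AddCircle.injective_toCircle one_ne_zero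
        rw [AddCircle.toCircle_zero]
        exact Circle.ext h1
      have h2 : ∫ k : K, UnitAddTorus.mFourier n (k : UnitAddTorus F) ∂μ =
          UnitAddTorus.mFourier n s * ∫ k : K, UnitAddTorus.mFourier n (k : UnitAddTorus F) ∂μ := by
        rw [← integral_const_mul]
        rw [← integral_add_left_eq_self _ (⟨s, hsK⟩ : K)]
        exact integral_congr_ae (Filter.Eventually.of_forall fun k => mFourier_add_apply n s k)
      have h3 : ∫ k : K, UnitAddTorus.mFourier n (k : UnitAddTorus F) ∂μ = 0 := by
        by_contra h3
        exact h1 (mul_right_cancel₀ h3 (by rw [← h2, one_mul]))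
      rw [h3, mul_zero, mul_zero]
  have hspan : ∀ x, ∀ f ∈ Submodule.span ℂ (Set.range (UnitAddTorus.mFourier (d := F))),
      L x f = L 0 f := by
    intro x f hf
    induction hf using Submodule.span_induction with
    | mem f hf =>
      obtain ⟨n, rfl⟩ := hf
      exact hchar x n
    | zero => simp
    | add f g _ _ hf hg => simp [hf, hg]
    | smul c f _ hf => simp [hf]
  have hcont : ∀ x, Continuous (L x) := fun x =>
    ((L x).mkContinuous _ (hbound x)).continuous
  have hall : ∀ x f, L x f = L 0 f := by
    intro x f
    have hcl : IsClosed {f | L x f = L 0 f} := isClosed_eq (hcont x) (hcont 0)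
    have hf : f ∈ (Submodule.span ℂ
        (Set.range (UnitAddTorus.mFourier (d := F)))).topologicalClosure := by
      rw [UnitAddTorus.span_mFourier_closure_eq_top]; trivial
    exact closure_minimal (hspan x) hcl hf
  intro x
  obtain ⟨φ, hφ⟩ : ∃ φ : C(UnitAddTorus F, ℝ), ∀ y, φ y = Metric.infDist y K :=
    ⟨⟨fun y => Metric.infDist y K, Metric.continuous_infDist_pt _⟩, fun _ => rfl⟩
  let f : C(UnitAddTorus F, ℂ) := ⟨fun y => (φ y : ℂ), by fun_prop⟩
  have h0 : L 0 f = 0 := by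
    change ∫ k : K, ((φ (0 + k) : ℝ) : ℂ) ∂μ = 0
    have : ∀ k : K, ((φ (0 + k) : ℝ) : ℂ) = 0 := fun k => by
      rw [zero_add, hφ]
      exact_mod_cast Metric.infDist_zero_of_mem k.2
    simp only [this, integral_zero]
  have hx : ∫ k : K, φ (x + k) ∂μ = 0 := by
    have := (hall x f).trans h0
    change ∫ k : K, ((φ (x + k) : ℝ) : ℂ) ∂μ = 0 at this
    rw [integral_complex_ofReal] at this
    exact_mod_cast this
  have hc : Continuous (fun k : K => φ (x + k)) := by fun_prop
  rw [integral_eq_zero_iff_of_nonneg (fun k => hφ (x + k) ▸ Metric.infDist_nonneg)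
    (hc.integrable_of_hasCompactSupport (HasCompactSupport.of_compactSpace _)),
    hc.ae_eq_iff_eq μ continuous_zero] at hx
  have := congr_fun hx 0
  have hxK : x ∈ K := by
    rw [← SetLike.mem_coe, hKc.mem_iff_infDist_zero ⟨0, K.zero_mem⟩]
    simpa [hφ] using this
  exact hxK

theorem denseRange_pi_addCircle {ι G : Type*} [AddCommGroup G] {f : ι → G →+ UnitAddCircle}
    (hf : LinearIndependent ℤ f) : DenseRange (fun g i => f i g) := by
  intro y
  rw [mem_closure_iff]
  intro o ho hy
  obtain ⟨I, u, hu, hsub⟩ := isOpen_pi_iff.1 ho y hy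
  let φ : G →+ UnitAddTorus I := AddMonoidHom.mk' (fun g i => f i g) (fun a b => by ext; simp)
  have hd : Dense (φ.range : Set (UnitAddTorus I)) := by
    refine dense_addSubgroup_of_forall_character _ fun n hn => ?_
    have h1 := linearIndependent_iff'.1 (hf.comp ((↑) : I → ι) Subtype.val_injective)
      Finset.univ n (by
        ext g
        rw [AddMonoidHom.finsetSum_apply]
        exact hn (φ g) ⟨g, rfl⟩)
    ext i
    exact h1 i (Finset.mem_univ i)
  obtain ⟨z, hz, g, rfl⟩ := hd.inter_open_nonempty (Set.univ.pi fun i : I => u i)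
    (isOpen_set_pi Set.finite_univ fun i _ => (hu i i.2).1)
    ⟨fun i => y i, fun i _ => (hu i i.2).2⟩
  exact ⟨_, hsub fun i hi => hz ⟨i, hi⟩ trivial, g, rfl⟩

theorem exists_addCircle_norm_sub_le {A : Type*} [AddCommGroup A] (z : A)
    (hz : 0 < addOrderOf z) (θ : UnitAddCircle) :
    ∃ ψ : A →+ UnitAddCircle, ‖ψ z - θ‖ ≤ 1 / addOrderOf z := by
  obtain ⟨t, rfl⟩ := QuotientAddGroup.mk_surjective θ
  set N := addOrderOf z
  have hN : (0 : ℝ) < N := by exact_mod_cast hz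
  obtain ⟨ψ, hψ⟩ := exists_addCircle_apply_eq z ((round (t * N) / N : ℝ) : UnitAddCircle) (by
    have : N • ((round (t * N) / N : ℝ) : UnitAddCircle) =
        ((N • (round (t * N) / N : ℝ) : ℝ) : UnitAddCircle) := rfl
    rw [this, nsmul_eq_mul, mul_div_cancel₀ _ hN.ne']
    exact (AddCircle.coe_eq_zero_iff _).2 ⟨round (t * N), by simp⟩)
  refine ⟨ψ, ?_⟩
  rw [hψ]
  refine (QuotientAddGroup.norm_mk_le_norm (S := AddSubgroup.zmultiples (1 : ℝ))
    (m := round (t * N) / N - t)).trans ?_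
  have h := abs_sub_round (t * N)
  rw [Real.norm_eq_abs, le_div_iff₀ hN, ← abs_of_pos hN, ← abs_mul, abs_of_pos hN, sub_mul,
    div_mul_cancel₀ _ hN.ne', abs_sub_comm]
  linarith

theorem exists_le_addOrderOf_quotient {H : Type*} [AddCommGroup H] (htors : IsAddTorsion H)
    (hunb : ¬ ∃ n : ℕ, 0 < n ∧ ∀ g : H, n • g = 0) (s : Finset H) (m : ℕ) :
    ∃ x : H, m ≤ addOrderOf (x : H ⧸ AddSubgroup.closure (s : Set H)) := by
  by_contra! hcon
  have hpos : ∀ x : H, 0 < addOrderOf x := fun x => (htors x).addOrderOf_pos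
  refine hunb ⟨(∏ a ∈ s, addOrderOf a) * m.factorial,
    Nat.mul_pos (Finset.prod_pos fun a _ => hpos a) m.factorial_pos, fun g => ?_⟩
  have h1 : m.factorial • g ∈ AddSubgroup.closure (s : Set H) := by
    rw [← QuotientAddGroup.eq_zero_iff, QuotientAddGroup.mk_nsmul]
    rw [← addOrderOf_dvd_iff_nsmul_eq_zero]
    have : addOrderOf (g : H ⧸ AddSubgroup.closure (s : Set H)) ∣ addOrderOf g :=
      addOrderOf_map_dvd (QuotientAddGroup.mk' _) g
    exact Nat.dvd_factorial (Nat.pos_of_dvd_of_pos this (hpos g)) (hcon g).le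
  rw [mul_smul]
  generalize m.factorial • g = y at h1
  induction h1 using AddSubgroup.closure_induction with
  | mem y hy =>
    exact addOrderOf_dvd_iff_nsmul_eq_zero.1 (Finset.dvd_prod_of_mem _ hy)
  | zero => simp
  | add a b _ _ ha hb => rw [smul_add, ha, hb, add_zero]
  | neg a _ ha => rw [smul_neg, ha, neg_zero]

theorem exists_seq_le_addOrderOf_quotient {H : Type*} [AddCommGroup H]
    (htors : IsAddTorsion H) (hunb : ¬ ∃ n : ℕ, 0 < n ∧ ∀ g : H, n • g = 0) :
    ∃ (x : ℕ → H) (S : ℕ → AddSubgroup H), (∀ n, (n + 1) ^ 2 ≤ addOrderOf (x n : H ⧸ S n)) ∧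
      ∀ n, ∀ k < n, x k ∈ S n := by
  classical
  choose c hc using exists_le_addOrderOf_quotient htors hunb
  obtain ⟨s, hs⟩ : ∃ s : ℕ → Finset H, ∀ n, s (n + 1) = insert (c (s n) ((n + 1) ^ 2)) (s n) :=
    ⟨fun n => Nat.rec ∅ (fun n s => insert (c s ((n + 1) ^ 2)) s) n, fun _ => rfl⟩
  refine ⟨fun n => c (s n) ((n + 1) ^ 2), fun n => AddSubgroup.closure (s n), fun n => hc _ _,
    fun n k hk => AddSubgroup.subset_closure ?_⟩
  induction n with
  | zero => omega
  | succ n ih =>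
    rw [hs]
    rcases Nat.lt_succ_iff_lt_or_eq.1 hk with h | rfl
    · exact Finset.mem_coe.2 (Finset.mem_insert_of_mem (ih h))
    · exact Finset.mem_coe.2 (Finset.mem_insert_self _ _)

theorem exists_addCircle_forall_norm_sub_le {H : Type*} [AddCommGroup H]
    {x : ℕ → H} {S : ℕ → AddSubgroup H}
    (hx : ∀ n, (n + 1) ^ 2 ≤ addOrderOf (x n : H ⧸ S n)) (hS : ∀ n, ∀ k < n, x k ∈ S n)
    (θ : ℕ → UnitAddCircle) :
    ∃ χ : H →+ UnitAddCircle, ∀ n, ‖χ (x n) - θ n‖ ≤ 1 / ((n : ℝ) + 1) ^ 2 := by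
  have hfin : ∀ n, ∃ χ : H →+ UnitAddCircle, ∀ k < n, ‖χ (x k) - θ k‖ ≤ 1 / ((k : ℝ) + 1) ^ 2 := by
    intro n
    induction n with
    | zero => exact ⟨0, by simp⟩
    | succ n ih =>
      obtain ⟨χ, hχ⟩ := ih
      obtain ⟨ψ, hψ⟩ := exists_addCircle_norm_sub_le (x n : H ⧸ S n)
        (lt_of_lt_of_le (by positivity) (hx n)) (θ n - χ (x n))
      refine ⟨χ + ψ.comp (QuotientAddGroup.mk' (S n)), fun k hk => ?_⟩
      rcases Nat.lt_succ_iff_lt_or_eq.1 hk with h | rfl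
      · have : ((x k : H) : H ⧸ S n) = 0 := (QuotientAddGroup.eq_zero_iff _).2 (hS n k h)
        simpa [this] using hχ k h
      · have h1 : (1 : ℝ) / addOrderOf (x k : H ⧸ S k) ≤ 1 / ((k : ℝ) + 1) ^ 2 :=
          one_div_le_one_div_of_le (by positivity) (by exact_mod_cast hx k)
        refine le_trans (le_of_eq ?_) (hψ.trans h1)
        congr 1
        simp only [AddMonoidHom.add_apply, AddMonoidHom.comp_apply, QuotientAddGroup.mk'_apply]
        abel
  let X : ℕ → Set (H → UnitAddCircle) := fun n =>
    {φ | (∀ a b, φ (a + b) = φ a + φ b) ∧ ∀ k < n, ‖φ (x k) - θ k‖ ≤ 1 / ((k : ℝ) + 1) ^ 2}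
  have hcl : ∀ n, IsClosed (X n) := by
    intro n
    refine IsClosed.and ?_ ?_
    · simp only [Set.ofPred_forall]
      exact isClosed_iInter fun a => isClosed_iInter fun b =>
        isClosed_eq (by fun_prop) (by fun_prop)
    · simp only [Set.ofPred_forall]
      exact isClosed_iInter fun k => isClosed_iInter fun _ =>
        isClosed_le (by fun_prop) (by fun_prop)
  obtain ⟨φ, hφ⟩ := IsCompact.nonempty_iInter_of_sequence_nonempty_isCompact_isClosed X
    (fun n φ hφ => ⟨hφ.1, fun k hk => hφ.2 k (hk.trans n.lt_succ_self)⟩)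
    (fun n => by
      obtain ⟨χ, hχ⟩ := hfin n
      exact ⟨χ, map_add χ, hχ⟩) (hcl 0).isCompact hcl
  rw [Set.mem_iInter] at hφ
  exact ⟨AddMonoidHom.mk' φ (hφ 0).1, fun n => (hφ (n + 1)).2 n n.lt_succ_self⟩

theorem exists_linearIndependent_character_of_isTorsion {H : Type*} [AddCommGroup H]
    (htors : IsAddTorsion H) (hunb : ¬ ∃ n : ℕ, 0 < n ∧ ∀ g : H, n • g = 0) :
    ∃ v : ℝ → H →+ UnitAddCircle, LinearIndependent ℤ v := by
  obtain ⟨x, S, hx, hS⟩ := exists_seq_le_addOrderOf_quotient htors hunb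
  choose χ hχ using fun r : ℝ => exists_addCircle_forall_norm_sub_le hx hS
    (fun n => ((r / (n + 1) : ℝ) : UnitAddCircle))
  obtain ⟨v, hv⟩ := exists_linearIndependent_int_real
  refine ⟨fun t => χ (v t), ?_⟩
  rw [linearIndependent_iff'] at hv ⊢
  intro s g hg
  refine hv s g ?_
  set r := ∑ i ∈ s, g i • v i with hr
  set B := ∑ i ∈ s, |(g i : ℝ)| with hB
  have key : ∀ n : ℕ, ‖((r / (n + 1) : ℝ) : UnitAddCircle)‖ ≤ B / ((n : ℝ) + 1) ^ 2 := by
    intro n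
    have h1 : ((r / (n + 1) : ℝ) : UnitAddCircle) =
        ∑ i ∈ s, g i • ((v i / (n + 1) : ℝ) : UnitAddCircle) := by
      have : r / (n + 1) = ∑ i ∈ s, g i • (v i / (n + 1)) := by
        rw [hr, Finset.sum_div]
        exact Finset.sum_congr rfl fun i _ => by simp only [zsmul_eq_mul]; ring
      rw [this]
      exact map_sum (QuotientAddGroup.mk' (AddSubgroup.zmultiples (1 : ℝ))) _ _
    have h2 : ∑ i ∈ s, g i • χ (v i) (x n) = 0 := by
      have := DFunLike.congr_fun hg (x n)
      rwa [AddMonoidHom.finsetSum_apply] at this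
    rw [← norm_neg, ← zero_sub, ← h2, h1, ← Finset.sum_sub_distrib, hB, Finset.sum_div]
    refine norm_sum_le_of_le _ fun i _ => ?_
    rw [← smul_sub, div_eq_mul_one_div |(g i : ℝ)|]
    refine (norm_zsmul_le _ _).trans ?_
    rw [Int.norm_eq_abs]
    exact mul_le_mul_of_nonneg_left (hχ (v i) n) (abs_nonneg _)
  by_contra hr0
  have hrpos : 0 < |r| := abs_pos.2 hr0
  obtain ⟨n, hn⟩ := exists_nat_gt (max (2 * |r|) (B / |r|))
  have hn1 : 2 * |r| < n + 1 := by linarith [le_max_left (2 * |r|) (B / |r|)]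
  have hn2 : B / |r| < n + 1 := by linarith [le_max_right (2 * |r|) (B / |r|)]
  have hpos : (0 : ℝ) < n + 1 := by positivity
  have h := key n
  rw [(AddCircle.norm_coe_eq_abs_iff (1 : ℝ) one_ne_zero).2, abs_div, abs_of_pos hpos] at h
  · rw [div_le_div_iff₀ hpos (by positivity)] at h
    rw [div_lt_iff₀ hrpos] at hn2
    nlinarith
  · rw [abs_div, abs_of_pos hpos, div_le_iff₀ hpos, abs_one]
    linarith

theorem exists_linearIndependent_character {H : Type*} [AddCommGroup H]
    (hunb : ¬ ∃ n : ℕ, 0 < n ∧ ∀ g : H, n • g = 0) :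
    ∃ v : ℝ → H →+ UnitAddCircle, LinearIndependent ℤ v := by
  by_cases htors : IsAddTorsion H
  · exact exists_linearIndependent_character_of_isTorsion htors hunb
  · obtain ⟨x, hx⟩ : ∃ x : H, ¬ IsOfFinAddOrder x := by
      simpa [IsAddTorsion] using htors
    obtain ⟨v, hv⟩ := exists_linearIndependent_addCircle
    choose χ hχ using fun t => exists_addCircle_apply_eq x (v t)
      (by rw [addOrderOf_eq_zero hx, zero_smul])
    refine ⟨χ, LinearIndependent.of_comp (AddMonoidHom.toIntLinearMap (AddMonoidHom.eval x)) ?_⟩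
    convert! hv using 1
    exact funext hχ

theorem exists_countable_unbounded_addSubgroup {G : Type*} [AddCommGroup G]
    (hunb : ¬ ∃ n : ℕ, 0 < n ∧ ∀ g : G, n • g = 0) :
    ∃ H : AddSubgroup G, Countable H ∧ ¬ ∃ n : ℕ, 0 < n ∧ ∀ g : H, n • g = 0 := by
  push Not at hunb
  choose x hx using fun n : ℕ => hunb (n + 1) n.succ_pos
  let L := Finsupp.linearCombination ℤ x
  refine ⟨L.range.toAddSubgroup, (Set.countable_range L).to_subtype, ?_⟩
  rintro ⟨n, hn, h⟩
  obtain ⟨m, rfl⟩ := Nat.exists_eq_succ_of_ne_zero hn.ne'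
  exact hx m (congr_arg Subtype.val (h ⟨x m, Finsupp.single m 1, by simp [L]⟩))

theorem mk_addCircle_le_continuum : #UnitAddCircle ≤ 𝔠 := by
  rw [← mk_real]
  exact mk_le_of_surjective (QuotientAddGroup.mk_surjective (s := AddSubgroup.zmultiples (1 : ℝ)))

theorem exists_surjective_real {P : Type} [Nonempty P] (h : #P ≤ 𝔠) :
    ∃ σ : ℝ → P, Function.Surjective σ := by
  rw [← mk_real] at h
  obtain ⟨e⟩ := h
  exact ⟨Function.invFun e, Function.invFun_surjective e.injective⟩

theorem exists_finset_filter_separating {I : Type*} {ι : I → Set ℝ} (hι : Function.Injective ι)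
    [∀ i r, Decidable (r ∈ ι i)] (s : Finset I) (i₀ : I) :
    ∃ F : Finset ℝ, ∀ i ∈ s, (F.filter (· ∈ ι i)) = (F.filter (· ∈ ι i₀)) → i = i₀ := by
  classical
  have h : ∀ i, ∃ r, i ≠ i₀ → ¬ (r ∈ ι i ↔ r ∈ ι i₀) := by
    intro i
    by_contra! hcon
    exact (hcon 0).1 (hι (Set.ext fun r => (hcon r).2))
  choose c hc using h
  refine ⟨s.image c, fun i hi hF => ?_⟩
  by_contra hne
  have hmem : c i ∈ s.image c := Finset.mem_image_of_mem c hi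
  have := Finset.ext_iff.1 hF (c i)
  simp only [Finset.mem_filter, hmem, true_and] at this
  exact hc i hne this

theorem exists_characters_separating_finsupp {A I : Type*} {C : Type} [AddCommGroup A]
    [AddCommGroup C] [Countable C] {ι : I → Set ℝ} (hι : Function.Injective ι)
    (j : (I →₀ C) →+ A) (hj : Function.Injective j) :
    ∃ g : ℝ → A →+ UnitAddCircle, ∀ z, z ≠ 0 → ∃ r, g r (j z) ≠ 0 := by
  classical
  let P := Finset ℝ × Finset (Finset ℝ) × (C →+ UnitAddCircle)
  have hP : #P ≤ 𝔠 := by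
    have h1 : #(C →+ UnitAddCircle) ≤ 𝔠 := by
      refine (mk_le_of_injective (DFunLike.coe_injective (F := C →+ UnitAddCircle))).trans ?_
      rw [← power_def]
      calc #UnitAddCircle ^ #C ≤ 𝔠 ^ ℵ₀ :=
            (power_le_power_right mk_addCircle_le_continuum).trans
              (power_le_power_left continuum_ne_zero mk_le_aleph0)
        _ = 𝔠 := continuum_power_aleph0
    simp only [P, mk_prod, lift_id, mk_finset_of_infinite, mk_real]
    exact mul_le_of_le aleph0_le_continuum le_rfl (mul_le_of_le aleph0_le_continuum le_rfl h1)
  obtain ⟨σ, hσ⟩ := exists_surjective_real hP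
  let χ : P → (I →₀ C) →+ UnitAddCircle := fun p =>
    Finsupp.liftAddHom fun i => if p.1.filter (· ∈ ι i) ∈ p.2.1 then p.2.2 else 0
  choose g hg using fun p => exists_addCircle_extension j (χ p) fun a ha => by
    rw [hj (ha.trans (map_zero j).symm), map_zero]
  refine ⟨fun r => g (σ r), fun z hz => ?_⟩
  obtain ⟨i₀, hi₀⟩ := Finsupp.ne_iff.1 hz
  obtain ⟨F, hF⟩ := exists_finset_filter_separating hι z.support i₀
  obtain ⟨u, hu⟩ := exists_addCircle_apply_ne_zero hi₀
  obtain ⟨r, hr⟩ := hσ (F, {F.filter (· ∈ ι i₀)}, u)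
  refine ⟨r, ?_⟩
  rw [hg, hr]
  have : χ (F, {F.filter (· ∈ ι i₀)}, u) z = u (z i₀) := by
    simp only [χ, Finsupp.liftAddHom_apply, Finsupp.sum, Finset.mem_singleton]
    rw [Finset.sum_eq_single i₀]
    · simp
    · intro i hi hne
      rw [if_neg fun h => hne (hF i hi h)]
      rfl
    · intro h
      simp [Finsupp.notMem_support_iff.1 h]
  rwa [this]

theorem exists_characters_separating_prime_torsion {A : Type*} [AddCommGroup A] {ι : A → Set ℝ}
    (hι : Function.Injective ι) {p : ℕ} (hp : p.Prime) :
    ∃ g : ℝ → A →+ UnitAddCircle, ∀ x : A, p • x = 0 → x ≠ 0 → ∃ r, g r x ≠ 0 := by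
  have : Fact p.Prime := ⟨hp⟩
  let B : AddSubgroup A := (nsmulAddMonoidHom (α := A) p).ker
  let _ : Module (ZMod p) B := AddCommGroup.zmodModule fun x => Subtype.ext x.2
  let b := Module.Basis.ofVectorSpace (ZMod p) B
  let j : (Module.Basis.ofVectorSpaceIndex (ZMod p) B →₀ ZMod p) →+ A :=
    B.subtype.comp b.repr.symm.toLinearMap.toAddMonoidHom
  obtain ⟨g, hg⟩ := exists_characters_separating_finsupp
    (ι := fun i : Module.Basis.ofVectorSpaceIndex (ZMod p) B => ι i.1)
    (fun i i' h => Subtype.ext (Subtype.ext (hι h))) j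
    (B.subtype_injective.comp b.repr.symm.injective)
  refine ⟨g, fun x hx hx0 => ?_⟩
  obtain ⟨z, hz⟩ := b.repr.symm.toEquiv.surjective ⟨x, hx⟩
  obtain rfl : j z = x := congr_arg Subtype.val hz
  exact hg z (by rintro rfl; exact hx0 (map_zero j))

theorem exists_characters_separating_infinite_order {A : Type*} [AddCommGroup A] {ι : A → Set ℝ}
    (hι : Function.Injective ι) :
    ∃ g : ℝ → A →+ UnitAddCircle, ∀ x : A, ¬ IsOfFinAddOrder x → ∃ r, g r x ≠ 0 := by
  obtain ⟨s, hs, hmax⟩ := exists_maximal_linearIndepOn ℤ (id : A → A)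
  let j := Finsupp.linearCombination ℤ (fun i : s => (i : A))
  obtain ⟨g, hg⟩ := exists_characters_separating_finsupp (I := s)
    (ι := fun i => ι i) (hι.comp Subtype.val_injective) j.toAddMonoidHom hs
  refine ⟨g, fun x hx => ?_⟩
  obtain ⟨a, ha, z, hz⟩ : ∃ a : ℤ, a ≠ 0 ∧ ∃ z, j z = a • x := by
    by_cases hxs : x ∈ s
    · exact ⟨1, one_ne_zero, Finsupp.single ⟨x, hxs⟩ 1, by simp [j]⟩
    · obtain ⟨a, ha, h⟩ := hmax x hxs
      refine ⟨a, ha, ?_⟩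
      have hr : Set.range (fun i : s => (i : A)) = id '' s := by simp
      rw [← hr, ← Finsupp.range_linearCombination] at h
      exact h
  have hax : a • x ≠ 0 := fun h => hx (isOfFinAddOrder_iff_zsmul_eq_zero.2 ⟨a, ha, h⟩)
  obtain ⟨r, hr⟩ := hg z (by
    rintro rfl
    exact hax (hz ▸ map_zero j))
  refine ⟨r, fun h => hr ?_⟩
  change g r (j z) = 0
  rw [hz, map_zsmul, h, smul_zero]

theorem exists_characters_separating {A : Type*} [AddCommGroup A] {ι : A → Set ℝ}
    (hι : Function.Injective ι) :
    ∃ g : ℝ → A →+ UnitAddCircle, ∀ x : A, x ≠ 0 → ∃ r, g r x ≠ 0 := by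
  obtain ⟨g₀, hg₀⟩ := exists_characters_separating_infinite_order hι
  choose g hg using fun p : Nat.Primes => exists_characters_separating_prime_torsion hι p.2
  obtain ⟨σ, hσ⟩ := exists_surjective_real (P := Option Nat.Primes × ℝ) (by
    rw [mk_prod, lift_id, lift_id, mk_real]
    exact mul_le_of_le aleph0_le_continuum (mk_le_aleph0.trans aleph0_le_continuum) le_rfl)
  refine ⟨fun r => (σ r).1.elim (g₀ (σ r).2) (fun p => g p (σ r).2), fun x hx => ?_⟩
  by_cases hfin : IsOfFinAddOrder x
  · obtain ⟨p, hp, k, hk⟩ := Nat.exists_prime_and_dvd (n := addOrderOf x) (by simpa using hx)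
    have hpos := hfin.addOrderOf_pos
    have hk0 : 0 < k := Nat.pos_of_ne_zero (by rintro rfl; omega)
    obtain ⟨r, hr⟩ := hg ⟨p, hp⟩ (k • x)
      (by rw [smul_smul]; exact hk ▸ addOrderOf_nsmul_eq_zero x) (fun h => by
        have := Nat.le_of_dvd hk0 (addOrderOf_dvd_iff_nsmul_eq_zero.2 h)
        rw [hk] at this
        nlinarith [hp.two_le])
    obtain ⟨t, ht⟩ := hσ (some ⟨p, hp⟩, r)
    refine ⟨t, fun h => hr ?_⟩
    have h' : g ⟨p, hp⟩ r x = 0 := by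
      beta_reduce at h
      rw [ht] at h
      exact h
    rw [map_nsmul, h', smul_zero]
  · obtain ⟨r, hr⟩ := hg₀ x hfin
    obtain ⟨t, ht⟩ := hσ (none, r)
    exact ⟨t, by simpa [ht] using hr⟩

theorem exists_independent_separating_characters {G : Type*} [AddCommGroup G] {ι : G → Set ℝ}
    (hι : Function.Injective ι) (hunb : ¬ ∃ n : ℕ, 0 < n ∧ ∀ g : G, n • g = 0) :
    ∃ f : ℝ → G →+ UnitAddCircle, LinearIndependent ℤ f ∧ ∀ x, x ≠ 0 → ∃ r, f r x ≠ 0 := by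
  obtain ⟨H, hHc, hH⟩ := exists_countable_unbounded_addSubgroup hunb
  obtain ⟨g, hg⟩ := exists_characters_separating (A := G ⧸ H) (ι := fun q => ι q.out)
    (hι.comp Quotient.out_injective)
  obtain ⟨v, hv⟩ := exists_linearIndependent_character hH
  obtain ⟨η, hη⟩ := exists_surjective_nat H
  have hψ : ∀ n, ∃ ψ : G →+ UnitAddCircle, η n ≠ 0 → ψ (η n) ≠ 0 := by
    intro n
    by_cases h : (η n : G) = 0
    · exact ⟨0, fun h' => absurd (Subtype.ext h) h'⟩
    · obtain ⟨ψ, hψ⟩ := exists_addCircle_apply_ne_zero h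
      exact ⟨ψ, fun _ => hψ⟩
  choose ψ hψ using hψ
  let π : G →+ (ℕ → UnitAddCircle) := AddMonoidHom.mk' (fun x n => ψ n x) fun a b => by ext; simp
  let j : H →+ (ℕ → UnitAddCircle) := π.comp H.subtype
  have hj : ∀ a, j a = 0 → a = 0 := by
    intro a ha
    obtain ⟨n, rfl⟩ := hη a
    by_contra h
    exact hψ n h (congr_fun ha n)
  let L := Finsupp.linearCombination ℤ (fun n => (ψ n).comp H.subtype)
  have : Countable L.range := (Set.countable_range L).to_subtype
  obtain ⟨w, hw⟩ := exists_linearIndependent_mkQ hv L.range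
  choose e he using fun t => exists_addCircle_extension j (w t) fun a ha => by
    rw [hj a ha, map_zero]
  obtain ⟨σ⟩ : Nonempty ((ℝ × (ℕ → UnitAddCircle)) × Bool ≃ ℝ) := by
    have h1 : #(ℕ → UnitAddCircle) ≤ 𝔠 := by
      rw [← power_def, mk_nat, ← continuum_power_aleph0]
      exact power_le_power_right mk_addCircle_le_continuum
    rw [← Cardinal.eq, mk_real]
    refine le_antisymm ?_ ?_
    · simp only [mk_prod, lift_id, mk_real]
      exact mul_le_of_le aleph0_le_continuum (mul_le_of_le aleph0_le_continuum le_rfl h1)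
        (mk_le_aleph0.trans aleph0_le_continuum)
    · rw [← mk_real]
      exact mk_le_of_injective (f := fun r => ((r, 0), true)) fun a b h => by simpa using h
  have hδ : ∀ (r : ℝ) (y : ℕ → UnitAddCircle), ∃ δ : (ℕ → UnitAddCircle) →+ UnitAddCircle,
      δ.comp j ∈ L.range ∧ (y ≠ 0 → e (σ ((r, y), false)) y ≠ (e (σ ((r, y), true)) + δ) y) := by
    intro r y
    by_cases h : e (σ ((r, y), false)) y = e (σ ((r, y), true)) y
    · by_cases hy : y = 0
      · exact ⟨0, L.range.zero_mem, fun h => absurd hy h⟩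
      · obtain ⟨n, hn⟩ := Function.ne_iff.1 hy
        exact ⟨Pi.evalAddMonoidHom _ n, ⟨Finsupp.single n 1, by ext; simp [L, j, π]⟩,
          fun _ => by simpa [h] using hn⟩
    · exact ⟨0, L.range.zero_mem, fun _ => by simpa using h⟩
  choose δ hδN hδ using hδ
  let d : (ℝ × (ℕ → UnitAddCircle)) × Bool → (ℕ → UnitAddCircle) →+ UnitAddCircle :=
    fun p => bif p.2 then δ p.1.1 p.1.2 else 0
  let f : (ℝ × (ℕ → UnitAddCircle)) × Bool → G →+ UnitAddCircle := fun p =>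
    (g p.1.1).comp (QuotientAddGroup.mk' H) + (e (σ p) + d p).comp π
  refine ⟨fun t => f (σ.symm t), ?_, fun x hx => ?_⟩
  · let R : (G →+ UnitAddCircle) →ₗ[ℤ] (H →+ UnitAddCircle) :=
      AddMonoidHom.toIntLinearMap
        (AddMonoidHom.mk' (fun χ => χ.comp H.subtype) fun a b => AddMonoidHom.add_comp a b _)
    refine LinearIndependent.of_comp (L.range.mkQ ∘ₗ R) ?_
    convert! hw using 1
    ext t
    have h1 : R (f (σ.symm t)) = w t + (d (σ.symm t)).comp j := by
      ext a
      have h0 : ((a : G) : G ⧸ H) = 0 := (QuotientAddGroup.eq_zero_iff _).2 a.2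
      have h2 := he t a
      simp only [j, AddMonoidHom.comp_apply, AddSubgroup.subtype_apply] at h2
      simp [R, f, j, h0, h2]
    have h3 : (d (σ.symm t)).comp j ∈ L.range := by
      rcases h : σ.symm t with ⟨⟨r, y⟩, b⟩
      cases b
      · exact L.range.zero_mem
      · exact hδN r y
    simp only [Function.comp_apply, LinearMap.comp_apply]
    rw [h1, map_add, (L.range.mkQ_apply _).trans ((Submodule.Quotient.mk_eq_zero _).2 h3), add_zero]
  · by_contra! hcon
    have hcon : ∀ p, f p x = 0 := fun p => by simpa using hcon (σ p)
    have hπ : π x = 0 := by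
      by_contra hπ
      have h1 := hcon ((0, π x), false)
      have h2 := hcon ((0, π x), true)
      refine hδ 0 (π x) hπ ?_
      have h3 := h1.trans h2.symm
      simpa [f, d] using h3
    have hxH : x ∈ H := by
      rw [← QuotientAddGroup.eq_zero_iff]
      by_contra hq
      obtain ⟨r, hr⟩ := hg _ hq
      refine hr ?_
      simpa [f, hπ] using hcon ((r, 0), false)
    exact hx (congr_arg Subtype.val (hj ⟨x, hxH⟩ hπ))

/-- An abelian group `G` is isomorphic to a dense subgroup of `𝕋^𝔠` (here `𝕋^𝔠` is
realized as `ℝ → AddCircle 1`, a product of continuum many copies of the circle) if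
and only if `G` is not bounded and `|G| ≤ 2^𝔠`. -/
theorem stmt12 {G : Type*} [AddCommGroup G] :
    (Cardinal.mk G ≤ (2 : Cardinal) ^ Cardinal.continuum ∧
        ¬ ∃ n : ℕ, 0 < n ∧ ∀ g : G, n • g = 0) ↔
      ∃ f : G →+ (ℝ → AddCircle (1 : ℝ)), Function.Injective f ∧ DenseRange f := by
  constructor
  · rintro ⟨hcard, hunb⟩
    obtain ⟨ι⟩ : Nonempty (G ↪ Set ℝ) := by
      rw [← lift_mk_le', mk_set, mk_real]
      simpa using hcard
    obtain ⟨f, hf, hsep⟩ := exists_independent_separating_characters ι.injective hunb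
    refine ⟨AddMonoidHom.mk' (fun x r => f r x) fun a b => by ext; simp, ?_,
      denseRange_pi_addCircle hf⟩
    rw [injective_iff_map_eq_zero]
    intro x hx
    by_contra hne
    obtain ⟨r, hr⟩ := hsep x hne
    exact hr (congr_fun hx r)
  · rintro ⟨f, hinj, hdense⟩
    refine ⟨?_, ?_⟩
    · have h1 := lift_mk_le_lift_mk_of_injective hinj
      have h2 : #(ℝ → AddCircle (1 : ℝ)) ≤ 2 ^ 𝔠 := by
        rw [← power_def, mk_real, ← power_self_eq aleph0_le_continuum]
        exact power_le_power_right mk_addCircle_le_continuum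
      have h3 := h1.trans (lift_le.2 h2)
      simpa using h3
    · rintro ⟨n, hn, h⟩
      have hcl : IsClosed {y : ℝ → AddCircle (1 : ℝ) | n • y = 0} :=
        isClosed_eq (by fun_prop) (by fun_prop)
      have hsub : Set.range f ⊆ {y : ℝ → AddCircle (1 : ℝ) | n • y = 0} := by
        rintro _ ⟨x, rfl⟩
        simp [← map_nsmul, h x]
      have hall : ∀ y : ℝ → AddCircle (1 : ℝ), n • y = 0 := fun y =>
        closure_minimal hsub hcl (hdense y)
      have h1 : n • ((1 / (n + 1 : ℕ) : ℝ) : AddCircle (1 : ℝ)) = 0 :=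
        congr_fun (hall fun _ => ((1 / (n + 1 : ℕ) : ℝ) : AddCircle (1 : ℝ))) 0
      have h2 := addOrderOf_dvd_iff_nsmul_eq_zero.2 h1
      rw [AddCircle.addOrderOf_period_div n.succ_pos] at h2
      exact absurd (Nat.le_of_dvd hn h2) (by omega)
end

section
/- Let G be an abelian group with its Bohr topology (denoted G^#). Then G^# has no infinite compact subsets. -/
/-- The canonical evaluation map of an abelian group `G` into the product
`𝕋^(Hom(G,𝕋))`.  The Bohr topology of `G` (giving `G^#`) is the initial topology
induced by all homomorphisms `G → 𝕋`, i.e. the topology induced by this map. -/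
noncomputable def bohrEval (G : Type*) [AddCommGroup G] : G → ((G →+ AddCircle (1 : ℝ)) → AddCircle (1 : ℝ)) :=
  fun g χ => χ g

open Filter Topology MeasureTheory

lemma exists_addCircle_character_ne_zero {A : Type*} [AddCommGroup A] {a : A} (ha : a ≠ 0) :
    ∃ χ : A →+ AddCircle (1 : ℝ), χ a ≠ 0 := by
  obtain ⟨c, hc⟩ := CharacterModule.exists_character_apply_ne_zero_of_ne_zero ha
  let j : AddCircle (1 : ℚ) →+ AddCircle (1 : ℝ) :=
    QuotientAddGroup.map _ _ (Rat.castHom ℝ).toAddMonoidHom (by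
      rw [AddSubgroup.zmultiples_le]
      exact AddSubgroup.mem_zmultiples_iff.2 ⟨1, by simp⟩)
  have hj : Function.Injective j := by
    rw [injective_iff_map_eq_zero]
    intro x
    induction x using QuotientAddGroup.induction_on with
    | H q =>
      intro hq
      obtain ⟨n, hn⟩ := (AddCircle.coe_eq_zero_iff (1 : ℝ) (x := (q : ℝ))).1 hq
      refine (AddCircle.coe_eq_zero_iff (1 : ℚ)).2 ⟨n, ?_⟩
      rw [zsmul_one] at hn ⊢
      exact_mod_cast hn
  exact ⟨j.comp c, fun h ↦ hc (hj (h.trans (map_zero j).symm))⟩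

/-- A sequence of nonzero elements cannot converge to zero in the Bohr topology: integrate the
characters over the compact dual group. -/
lemma not_forall_character_tendsto_zero {G : Type*} [AddCommGroup G] {a : ℕ → G}
    (ha : ∀ n, a n ≠ 0) :
    ¬ ∀ χ : G →+ AddCircle (1 : ℝ), Tendsto (fun n ↦ χ (a n)) atTop (𝓝 0) := by
  intro h
  let K : AddSubgroup (G → AddCircle (1 : ℝ)) :=
    (AddMonoidHom.coeFn G (AddCircle (1 : ℝ))).range
  have hK : IsClosed (K : Set (G → AddCircle (1 : ℝ))) :=
    AddMonoidHom.isClosed_range_coe G (AddCircle (1 : ℝ))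
  have : CompactSpace K := isCompact_iff_compactSpace.1 hK.isCompact
  let : MeasurableSpace K := borel K
  have : BorelSpace K := ⟨rfl⟩
  let μ : Measure K := Measure.addHaar
  let F : G → K → ℂ := fun g f ↦ ((f.1 g).toCircle : ℂ)
  have hF (g : G) : Continuous (F g) :=
    continuous_subtype_val.comp (AddCircle.continuous_toCircle.comp
      ((continuous_apply g).comp continuous_subtype_val))
  have hzero (g : G) (hg : g ≠ 0) : ∫ f, F g f ∂μ = 0 := by
    obtain ⟨χ, hχ⟩ := exists_addCircle_character_ne_zero hg
    have hinv := integral_add_left_eq_self (μ := μ) (F g) ⟨χ, χ, rfl⟩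
    have hmul (f : K) : F g (⟨χ, χ, rfl⟩ + f) = ((χ g).toCircle : ℂ) * F g f := by
      simp [F, AddCircle.toCircle_add]
    simp_rw [hmul, integral_const_mul] at hinv
    by_contra hne
    refine hχ (AddCircle.injective_toCircle one_ne_zero (Circle.ext ?_))
    simpa using mul_right_cancel₀ hne (hinv.trans (one_mul _).symm)
  have hlim : Tendsto (fun n ↦ ∫ f, F (a n) f ∂μ) atTop (𝓝 (∫ _, (1 : ℂ) ∂μ)) := by
    refine tendsto_integral_of_dominated_convergence (fun _ ↦ 1)
      (fun n ↦ (hF (a n)).aestronglyMeasurable) (integrable_const _)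
      (fun n ↦ .of_forall fun f ↦ (Circle.norm_coe _).le) (.of_forall ?_)
    rintro ⟨_, χ, rfl⟩
    have hcont : Continuous fun t : AddCircle (1 : ℝ) ↦ (t.toCircle : ℂ) :=
      continuous_subtype_val.comp AddCircle.continuous_toCircle
    simpa [F, Function.comp_def] using (hcont.tendsto 0).comp (h χ)
  simp_rw [hzero _ (ha _)] at hlim
  have h0 := tendsto_nhds_unique hlim tendsto_const_nhds
  simp [measureReal_def, ENNReal.toReal_eq_zero_iff, measure_ne_top] at h0
  exact NeZero.ne μ h0

lemma exists_countable_separating_characters {G : Type*} [AddCommGroup G] {H : Set G}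
    (hH : H.Countable) : ∃ D : Set (G →+ AddCircle (1 : ℝ)), D.Countable ∧
      ∀ x ∈ H, ∀ y ∈ H, (∀ χ ∈ D, χ x = χ y) → x = y := by
  have hex (p : G) : ∃ χ : G →+ AddCircle (1 : ℝ), p ≠ 0 → χ p ≠ 0 := by
    by_cases hp : p = 0
    · exact ⟨0, fun h ↦ (h hp).elim⟩
    · obtain ⟨χ, hχ⟩ := exists_addCircle_character_ne_zero hp
      exact ⟨χ, fun _ ↦ hχ⟩
  choose c hc using hex
  refine ⟨(fun p : G × G ↦ c (p.1 - p.2)) '' H ×ˢ H, (hH.prod hH).image _, ?_⟩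
  intro x hx y hy hxy
  by_contra hne
  refine hc (x - y) (sub_ne_zero.2 hne) ?_
  rw [map_sub, sub_eq_zero]
  exact hxy _ ⟨(x, y), ⟨hx, hy⟩, rfl⟩

lemma isClosed_addSubgroup_of_characters_continuous {G : Type*} [AddCommGroup G]
    [TopologicalSpace G] (hχ : ∀ χ : G →+ AddCircle (1 : ℝ), Continuous χ) (H : AddSubgroup G) :
    IsClosed (H : Set G) := by
  have : (H : Set G) = ⋂ χ : (G ⧸ H) →+ AddCircle (1 : ℝ),
      (χ.comp (QuotientAddGroup.mk' H)) ⁻¹' {0} := by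
    ext g
    simp only [SetLike.mem_coe, Set.mem_iInter, Set.mem_preimage, Set.mem_singleton_iff]
    rw [← QuotientAddGroup.eq_zero_iff]
    refine ⟨fun h χ ↦ by simp [h], fun h ↦ ?_⟩
    by_contra hne
    obtain ⟨χ, hχg⟩ := exists_addCircle_character_ne_zero hne
    exact hχg (h χ)
  rw [this]
  exact isClosed_iInter fun χ ↦ isClosed_singleton.preimage (hχ _)

/-- Glicksberg's theorem: an abelian group `G^#` with its Bohr topology has no
infinite compact subsets. -/
theorem stmt16 {G : Type*} [AddCommGroup G] (C : Set G)
    (hC : @IsCompact G (TopologicalSpace.induced (bohrEval G) inferInstance) C) :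
    C.Finite := by
  let : TopologicalSpace G := TopologicalSpace.induced (bohrEval G) inferInstance
  have hχ (χ : G →+ AddCircle (1 : ℝ)) : Continuous χ :=
    (continuous_apply χ).comp (continuous_induced_dom (f := bohrEval G))
  by_contra hinf
  let x : ℕ ↪ C := Set.Infinite.natEmbedding C hinf
  let H : AddSubgroup G :=
    (Finsupp.linearCombination ℤ fun n ↦ (x n : G)).toAddMonoidHom.range
  have hxH (n : ℕ) : (x n : G) ∈ H := ⟨Finsupp.single n 1, by simp⟩
  have hH : (H : Set G).Countable := Set.countable_range _
  obtain ⟨D, hD, hsep⟩ :=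
    exists_countable_separating_characters hH
  have : Countable D := hD.to_subtype
  let S : Set G := C ∩ H
  have : CompactSpace S := isCompact_iff_compactSpace.1
    (hC.inter_right (isClosed_addSubgroup_of_characters_continuous hχ H))
  let e : S → D → AddCircle (1 : ℝ) := fun s χ ↦ χ.1 s
  have he : IsClosedEmbedding e := by
    refine Continuous.isClosedEmbedding
      (continuous_pi fun χ ↦ (hχ χ.1).comp continuous_subtype_val) fun s t hst ↦ ?_
    exact Subtype.ext (hsep s s.2.2 t t.2.2 fun χ hχD ↦ congrFun hst ⟨χ, hχD⟩)
  have : FirstCountableTopology S := he.isEmbedding.isInducing.firstCountableTopology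
  obtain ⟨s, φ, hφ, hs⟩ := CompactSpace.tendsto_subseq
    (fun n ↦ (⟨x n, (x n).2, hxH n⟩ : S))
  have hinj : Function.Injective fun n ↦ (x (φ n) : G) :=
    Subtype.val_injective.comp (x.injective.comp hφ.injective)
  have hev : ∀ᶠ n in atTop, (x (φ n) : G) - s ≠ 0 := by
    have := (Nat.cofinite_eq_atTop ▸ hinj.tendsto_cofinite).eventually
      (Set.finite_singleton (s : G)).compl_mem_cofinite
    filter_upwards [this] with n hn h
    exact hn (sub_eq_zero.1 h)
  obtain ⟨N, hN⟩ := eventually_atTop.1 hev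
  refine not_forall_character_tendsto_zero
    (a := fun n ↦ (x (φ (n + N)) : G) - s) (fun n ↦ hN _ (Nat.le_add_left N n)) fun χ ↦ ?_
  have hlim : Tendsto (fun n ↦ χ (x (φ n))) atTop (𝓝 (χ s)) :=
    (((hχ χ).comp continuous_subtype_val).tendsto s).comp hs
  have hsub := ((tendsto_add_atTop_iff_nat N).2 hlim).sub_const (χ s)
  simpa only [map_sub, sub_self] using hsub
end

section
/- Let G be an abelian group and X an infinite subset of G. Then the closure of X in the Bohr compactification bG of G has cardinality at least 2^𝔠, where 𝔠 is the cardinality of the continuum. -/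
section

open Set

/-- Two closed disjoint symmetric arcs of the circle, each of length `1/3`. -/
def bohrArc (j : Bool) : Set UnitAddCircle :=
  if j then {t | 1 / 3 ≤ ‖t‖} else {t | ‖t‖ ≤ 1 / 6}

theorem isClosed_bohrArc (j : Bool) : IsClosed (bohrArc j) := by
  cases j
  · simpa [bohrArc] using isClosed_le (continuous_norm (E := UnitAddCircle)) continuous_const
  · simpa [bohrArc] using isClosed_le continuous_const (continuous_norm (E := UnitAddCircle))

theorem eq_of_mem_bohrArc {i j : Bool} {t : UnitAddCircle} (hi : t ∈ bohrArc i)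
    (hj : t ∈ bohrArc j) : i = j := by
  cases i <;> cases j <;> simp [bohrArc] at hi hj ⊢ <;> linarith

theorem neg_mem_bohrArc {j : Bool} {t : UnitAddCircle} (h : t ∈ bohrArc j) : -t ∈ bohrArc j := by
  cases j <;> simpa [bohrArc] using h

theorem exists_forall_coe_mem_bohrArc (j : Bool) :
    ∃ α : ℝ, ∀ r ∈ Icc α (α + 1 / 3), (r : UnitAddCircle) ∈ bohrArc j := by
  cases j
  · refine ⟨-(1 / 6), fun r hr => ?_⟩
    have h : |r - round r| ≤ |r - (0 : ℤ)| := round_le r 0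
    simp only [bohrArc, Bool.false_eq_true, if_false, mem_ofPred_eq, UnitAddCircle.norm_eq]
    refine h.trans ?_
    rw [abs_le]
    constructor <;> push_cast <;> linarith [hr.1, hr.2]
  · refine ⟨1 / 3, fun r hr => ?_⟩
    simp only [bohrArc, if_true, mem_ofPred_eq, UnitAddCircle.norm_eq]
    rcases le_or_gt (round r) 0 with h | h
    · have : ((round r : ℤ) : ℝ) ≤ 0 := by exact_mod_cast h
      exact le_abs.2 (Or.inl (by linarith [hr.1]))
    · have : (1 : ℝ) ≤ ((round r : ℤ) : ℝ) := by exact_mod_cast h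
      exact le_abs.2 (Or.inr (by linarith [hr.2]))

theorem exists_add_zsmul_coe_mem_bohrArc {r : ℝ} (h0 : 0 < r) (h1 : r ≤ 1 / 3)
    (c : UnitAddCircle) (j : Bool) : ∃ n : ℤ, c + n • (r : UnitAddCircle) ∈ bohrArc j := by
  obtain ⟨α, hα⟩ := exists_forall_coe_mem_bohrArc j
  induction c using QuotientAddGroup.induction_on with
  | H c =>
    refine ⟨⌈(α - c) / r⌉, ?_⟩
    have h2 := Int.le_ceil ((α - c) / r)
    have h3 := Int.ceil_lt_add_one ((α - c) / r)
    rw [div_le_iff₀ h0] at h2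
    rw [← sub_lt_iff_lt_add, lt_div_iff₀ h0] at h3
    have := hα (c + ⌈(α - c) / r⌉ * r) ⟨by linarith, by linarith⟩
    simpa [← zsmul_eq_mul] using this

theorem exists_zsmul_eq_coe_le_third {s : UnitAddCircle} (hs : (2 : ℤ) • s ≠ 0) :
    ∃ (k : ℤ) (r : ℝ), 0 < r ∧ r ≤ 1 / 3 ∧ k • s = (r : UnitAddCircle) := by
  obtain ⟨u, ε, hu0, hu1, hε⟩ : ∃ (u : ℝ) (ε : ℤ), 0 ≤ u ∧ u ≤ 1 / 2 ∧
      ((u : ℝ) : UnitAddCircle) = ε • s ∧ s = ε • ((u : ℝ) : UnitAddCircle) := by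
    induction s using QuotientAddGroup.induction_on with
    | H t =>
      have ht : ((t - round t : ℝ) : UnitAddCircle) = (t : UnitAddCircle) := by
        have : (((round t : ℤ) : ℝ) : UnitAddCircle) = 0 := by
          rw [AddCircle.coe_eq_zero_iff]
          exact ⟨round t, by simp⟩
        rw [AddCircle.coe_sub, this, sub_zero]
      have hb := abs_sub_round t
      rcases abs_cases (t - round t) with ⟨h, h'⟩ | ⟨h, h'⟩
      · exact ⟨t - round t, 1, h', by linarith, by rw [ht, one_zsmul], by
          rw [ht, one_zsmul]⟩
      · exact ⟨-(t - round t), -1, by linarith, by linarith, by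
          rw [AddCircle.coe_neg, ht, neg_one_zsmul], by
          rw [AddCircle.coe_neg, ht, neg_one_zsmul, neg_neg]⟩
  obtain ⟨h1, h2⟩ := hε
  have one : ((1 : ℝ) : UnitAddCircle) = 0 := AddCircle.coe_period 1
  have two (v : ℝ) : (2 : ℤ) • (v : UnitAddCircle) = ((2 * v : ℝ) : UnitAddCircle) := by
    rw [← AddCircle.coe_zsmul, zsmul_eq_mul]; norm_num
  have hu0' : u ≠ 0 := by
    rintro rfl
    exact hs (by rw [h2]; simp)
  have hu1' : u ≠ 1 / 2 := by
    rintro rfl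
    refine hs ?_
    rw [h2, smul_comm, two]
    norm_num [one]
  by_cases h : u ≤ 1 / 3
  · exact ⟨ε, u, lt_of_le_of_ne hu0 hu0'.symm, h, h1.symm⟩
  · refine ⟨-(2 * ε), 1 - 2 * u, ?_, by linarith, ?_⟩
    · have := lt_of_le_of_ne hu1 hu1'
      linarith
    · rw [neg_smul, mul_smul, ← h1, two, AddCircle.coe_sub, one, zero_sub]

theorem exists_add_zsmul_mem_bohrArc {s : UnitAddCircle} (hs : (2 : ℤ) • s ≠ 0)
    (c : UnitAddCircle) (j : Bool) : ∃ n : ℤ, c + n • s ∈ bohrArc j := by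
  obtain ⟨k, r, h0, h1, hk⟩ := exists_zsmul_eq_coe_le_third hs
  obtain ⟨n, hn⟩ := exists_add_zsmul_coe_mem_bohrArc h0 h1 c j
  exact ⟨n * k, by rwa [mul_smul, hk]⟩

theorem UnitAddCircle.eq_zero_or_eq_half {t : UnitAddCircle} (h : (2 : ℤ) • t = 0) :
    t = 0 ∨ t = ((1 / 2 : ℝ) : UnitAddCircle) := by
  induction t using QuotientAddGroup.induction_on with
  | H t =>
    have h' : ((2 * t : ℝ) : UnitAddCircle) = 0 := by
      rw [← h]
      change _ = (2 : ℤ) • ((t : ℝ) : UnitAddCircle)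
      rw [← AddCircle.coe_zsmul, zsmul_eq_mul]
      norm_num
    rw [AddCircle.coe_eq_zero_iff] at h'
    obtain ⟨n, hn⟩ := h'
    rw [zsmul_eq_mul, mul_one] at hn
    rcases Int.even_or_odd' n with ⟨k, rfl | rfl⟩
    · left
      change ((t : ℝ) : UnitAddCircle) = 0
      rw [AddCircle.coe_eq_zero_iff]
      exact ⟨k, by push_cast at hn; rw [zsmul_eq_mul]; linarith⟩
    · right
      change ((t : ℝ) : UnitAddCircle) = _
      rw [← sub_eq_zero, ← AddCircle.coe_sub, AddCircle.coe_eq_zero_iff]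
      exact ⟨k, by push_cast at hn; rw [zsmul_eq_mul]; linarith⟩

theorem exists_add_zsmul_mem_bohrArc_of_two_zsmul {s : UnitAddCircle} (hs : s ≠ 0)
    (hs2 : (2 : ℤ) • s = 0) {c : UnitAddCircle} (hc : (2 : ℤ) • c = 0) (j : Bool) :
    ∃ n : ℤ, c + n • s ∈ bohrArc j := by
  have half : ‖((1 / 2 : ℝ) : UnitAddCircle)‖ = 1 / 2 := by
    have := AddCircle.norm_half_period_eq (p := (1 : ℝ))
    simpa using this
  have hh : s = ((1 / 2 : ℝ) : UnitAddCircle) :=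
    (UnitAddCircle.eq_zero_or_eq_half hs2).resolve_left hs
  have z : (0 : UnitAddCircle) ∈ bohrArc false := by simp [bohrArc]
  have o : s ∈ bohrArc true := by
    rw [hh]
    simp only [bohrArc, if_true, mem_ofPred_eq, half]
    norm_num
  have ss : s + s = 0 := by rw [← two_zsmul, hs2]
  rcases UnitAddCircle.eq_zero_or_eq_half hc with rfl | h
  · cases j
    · exact ⟨0, by simpa using z⟩
    · exact ⟨1, by simpa using o⟩
  · rw [← hh] at h
    subst h
    cases j
    · exact ⟨1, by simpa [ss] using z⟩
    · exact ⟨0, by simpa using o⟩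

theorem exists_unitAddCircle_character_ne_zero {G : Type*} [AddCommGroup G] (H : AddSubgroup G)
    {a : G} (ha : a ∉ H) : ∃ ψ : G →+ UnitAddCircle, (∀ y ∈ H, ψ y = 0) ∧ ψ a ≠ 0 := by
  have ha' : (QuotientAddGroup.mk a : G ⧸ H) ≠ 0 := by
    rwa [Ne, QuotientAddGroup.eq_zero_iff]
  obtain ⟨c, hc⟩ := CharacterModule.exists_character_apply_ne_zero_of_ne_zero ha'
  let c' : G ⧸ H →+ AddCircle (1 : ℚ) := c
  let ι : AddCircle (1 : ℚ) →+ UnitAddCircle :=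
    QuotientAddGroup.map _ _ (Rat.castHom ℝ).toAddMonoidHom (by
      rintro _ ⟨n, rfl⟩
      exact ⟨n, by simp⟩)
  have hι : ∀ t, ι t = 0 → t = 0 := by
    intro t ht
    induction t using QuotientAddGroup.induction_on with
    | H t =>
      have ht' : (((t : ℚ) : ℝ) : UnitAddCircle) = 0 := ht
      rw [AddCircle.coe_eq_zero_iff] at ht'
      obtain ⟨n, hn⟩ := ht'
      refine (QuotientAddGroup.eq_zero_iff _).2 ⟨n, ?_⟩
      simp only [zsmul_eq_mul, mul_one] at hn ⊢
      exact_mod_cast hn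
  refine ⟨(ι.comp c').comp (QuotientAddGroup.mk' H), fun y hy => ?_, fun h => hc (hι _ h)⟩
  have : QuotientAddGroup.mk' H y = 0 := (QuotientAddGroup.eq_zero_iff y).2 hy
  rw [AddMonoidHom.comp_apply, this, map_zero]

theorem exists_character_forall_mem_bohrArc {G : Type*} [AddCommGroup G] (y : ℕ → G)
    (ε : ℕ → Bool) (h : ∀ N, ∃ χ : G →+ UnitAddCircle, ∀ n < N, χ (y n) ∈ bohrArc (ε n)) :
    ∃ χ : G →+ UnitAddCircle, ∀ n, χ (y n) ∈ bohrArc (ε n) := by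
  let C : ℕ → Set (G → UnitAddCircle) := fun N =>
    {f | ∀ a b, f (a + b) = f a + f b} ∩ {f | ∀ n < N, f (y n) ∈ bohrArc (ε n)}
  have hC : ∀ N, IsClosed (C N) := by
    intro N
    refine IsClosed.inter ?_ ?_
    · simp only [ofPred_forall]
      exact isClosed_iInter fun a => isClosed_iInter fun b => isClosed_eq (by fun_prop) (by fun_prop)
    · simp only [ofPred_forall]
      exact isClosed_iInter fun n => isClosed_iInter fun _ =>
        (isClosed_bohrArc (ε n)).preimage (continuous_apply (y n))
  obtain ⟨f, hf⟩ := IsCompact.nonempty_iInter_of_sequence_nonempty_isCompact_isClosed C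
    (fun N f hf => ⟨hf.1, fun n hn => hf.2 n (hn.trans N.lt_succ_self)⟩)
    (fun N => by
      obtain ⟨χ, hχ⟩ := h N
      exact ⟨χ, fun a b => map_add χ a b, hχ⟩)
    (hC 0).isCompact hC
  rw [mem_iInter] at hf
  exact ⟨AddMonoidHom.mk' f (hf 0).1, fun n => (hf (n + 1)).2 n n.lt_succ_self⟩

/-- `Y` contains a sequence on which characters realize every pattern of membership in the two
arcs `bohrArc`. -/
def HasInterpolatingSeq {G : Type*} [AddCommGroup G] (Y : Set G) : Prop :=
  ∃ y : ℕ → G, (∀ n, y n ∈ Y) ∧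
    ∀ ε : ℕ → Bool, ∃ χ : G →+ UnitAddCircle, ∀ n, χ (y n) ∈ bohrArc (ε n)

theorem hasInterpolatingSeq_of_forall_finset {G : Type*} [AddCommGroup G] {Y : Set G}
    (h : ∀ F : Finset G, (F : Set G) ⊆ Y → ∃ x ∈ Y, ∀ (χ : G →+ UnitAddCircle) (j : Bool),
      ∃ ψ : G →+ UnitAddCircle, (∀ y ∈ F, ψ y = χ y) ∧ ψ x ∈ bohrArc j) :
    HasInterpolatingSeq Y := by
  classical
  choose g hgY hg using fun F : {F : Finset G // (F : Set G) ⊆ Y} => h F.1 F.2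
  let S : ℕ → {F : Finset G // (F : Set G) ⊆ Y} := fun n =>
    Nat.rec ⟨∅, by simp⟩ (fun _ F => ⟨insert (g F) F.1, by
      rw [Finset.coe_insert]
      exact insert_subset (hgY F) F.2⟩) n
  have hS : ∀ n, (S (n + 1)).1 = insert (g (S n)) (S n).1 := fun n => rfl
  have hmem : ∀ n, ∀ i < n, g (S i) ∈ (S n).1 := by
    intro n
    induction n with
    | zero => simp
    | succ n ih =>
      intro i hi
      rw [hS, Finset.mem_insert]
      rcases Nat.lt_succ_iff_lt_or_eq.1 hi with hi | rfl
      · exact Or.inr (ih i hi)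
      · exact Or.inl rfl
  refine ⟨fun n => g (S n), fun n => hgY _,
    fun ε => exists_character_forall_mem_bohrArc _ ε fun N => ?_⟩
  induction N with
  | zero => exact ⟨0, by simp⟩
  | succ N ih =>
    obtain ⟨χ, hχ⟩ := ih
    obtain ⟨ψ, hψ, hψN⟩ := hg (S N) χ (ε N)
    refine ⟨ψ, fun n hn => ?_⟩
    rcases Nat.lt_succ_iff_lt_or_eq.1 hn with hn | rfl
    · rw [hψ _ (hmem N n hn)]
      exact hχ n hn
    · exact hψN

theorem exists_lacunary_seq {Z : Set ℤ} (hZ : Z.Infinite) :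
    ∃ z : ℕ → ℤ, (∀ n, z n ∈ Z) ∧ (∀ n, 0 < |z n|) ∧ ∀ n, 6 * |z n| ≤ |z (n + 1)| := by
  have key : ∀ M : ℤ, ∃ z ∈ Z, M < |z| := by
    intro M
    by_contra! h
    exact hZ ((finite_Icc (-M) M).subset fun z hz => abs_le.1 (h z hz))
  choose g hgZ hg using key
  let z : ℕ → ℤ := fun n => Nat.rec (g 0) (fun _ w => g (6 * |w|)) n
  have hz : ∀ n, z (n + 1) = g (6 * |z n|) := fun n => rfl
  refine ⟨z, fun n => ?_, fun n => ?_, fun n => ?_⟩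
  · cases n <;> exact hgZ _
  · cases n with
    | zero => exact hg 0
    | succ n =>
      rw [hz]
      exact lt_of_le_of_lt (by positivity) (hg _)
  · rw [hz]
    exact (hg _).le

theorem exists_interval_forall_mem_bohrArc {z : ℕ → ℤ} (hpos : ∀ n, 0 < |z n|)
    (hz : ∀ n, 6 * |z n| ≤ |z (n + 1)|) (ε : ℕ → Bool) (N : ℕ) :
    ∃ a : ℝ, ∀ θ ∈ Icc a (a + 1 / (3 * |(z N : ℝ)|)), ∀ n ≤ N,
      ((|(z n : ℝ)| * θ : ℝ) : UnitAddCircle) ∈ bohrArc (ε n) := by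
  have step : ∀ (n : ℕ) (b : ℝ), ∃ a : ℝ, b ≤ a ∧ a ≤ b + 1 / |(z n : ℝ)| ∧
      ∀ θ ∈ Icc a (a + 1 / (3 * |(z n : ℝ)|)),
        ((|(z n : ℝ)| * θ : ℝ) : UnitAddCircle) ∈ bohrArc (ε n) := by
    intro n b
    have hw : 0 < |(z n : ℝ)| := by exact_mod_cast hpos n
    set w := |(z n : ℝ)|
    obtain ⟨α, hα⟩ := exists_forall_coe_mem_bohrArc (ε n)
    have h1 := Int.le_ceil (w * b - α)
    have h2 := (Int.ceil_lt_add_one (w * b - α)).le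
    set k := ⌈w * b - α⌉
    refine ⟨(α + k) / w, ?_, ?_, fun θ hθ => ?_⟩
    · rw [le_div_iff₀ hw]; linarith
    · rw [div_le_iff₀ hw, add_mul, one_div_mul_cancel hw.ne']; linarith
    · have h3 : α + k ≤ w * θ := by
        have := hθ.1
        rw [div_le_iff₀ hw] at this
        linarith
      have h4 : w * θ ≤ α + k + 1 / 3 := by
        have h5 := mul_le_mul_of_nonneg_left hθ.2 hw.le
        have h6 : w * ((α + k) / w + 1 / (3 * w)) = α + k + 1 / 3 := by field_simp
        linarith
      have h7 := hα (w * θ - k) ⟨by linarith, by linarith⟩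
      have h8 : ((k : ℝ) : UnitAddCircle) = 0 := by
        rw [AddCircle.coe_eq_zero_iff]
        exact ⟨k, by simp⟩
      rwa [AddCircle.coe_sub, h8, sub_zero] at h7
  induction N with
  | zero =>
    obtain ⟨a, -, -, ha⟩ := step 0 0
    exact ⟨a, fun θ hθ n hn => by
      obtain rfl := Nat.le_zero.1 hn
      exact ha θ hθ⟩
  | succ N ih =>
    obtain ⟨b, hb⟩ := ih
    obtain ⟨a, hba, hab, ha⟩ := step (N + 1) b
    refine ⟨a, fun θ hθ n hn => ?_⟩
    rcases Nat.le_succ_iff.1 hn with hn | rfl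
    · refine hb θ ⟨hba.trans hθ.1, hθ.2.trans ?_⟩ n hn
      have hw : 0 < |(z N : ℝ)| := by exact_mod_cast hpos N
      have hw' : 6 * |(z N : ℝ)| ≤ |(z (N + 1) : ℝ)| := by exact_mod_cast hz N
      have e1 : 1 / |(z (N + 1) : ℝ)| ≤ 1 / (6 * |(z N : ℝ)|) :=
        one_div_le_one_div_of_le (by positivity) hw'
      have e2 : 1 / (3 * |(z (N + 1) : ℝ)|) = 1 / |(z (N + 1) : ℝ)| / 3 := by
        rw [div_div, mul_comm]
      have e3 : 1 / (3 * |(z N : ℝ)|) = 1 / (6 * |(z N : ℝ)|) * 2 := by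
        field_simp; norm_num
      have e4 : 0 < 1 / (6 * |(z N : ℝ)|) := by positivity
      linarith
    · exact ha θ hθ

theorem hasInterpolatingSeq_int {Z : Set ℤ} (hZ : Z.Infinite) : HasInterpolatingSeq Z := by
  obtain ⟨z, hzZ, hpos, hz⟩ := exists_lacunary_seq hZ
  refine ⟨z, hzZ, fun ε => exists_character_forall_mem_bohrArc z ε fun N => ?_⟩
  obtain ⟨a, ha⟩ := exists_interval_forall_mem_bohrArc hpos hz ε N
  refine ⟨(zmultiplesHom UnitAddCircle) (a : UnitAddCircle), fun n hn => ?_⟩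
  have h := ha a ⟨le_rfl, by simp⟩ n hn.le
  have e : zmultiplesHom UnitAddCircle (a : UnitAddCircle) (z n) =
      (((z n : ℝ) * a : ℝ) : UnitAddCircle) := by
    rw [zmultiplesHom_apply, ← AddCircle.coe_zsmul, zsmul_eq_mul]
  rw [e]
  rcases abs_choice (z n : ℝ) with h' | h' <;> rw [h'] at h
  · exact h
  · have := neg_mem_bohrArc h
    rwa [← AddCircle.coe_neg, neg_mul, neg_neg] at this

theorem HasInterpolatingSeq.of_image {G K : Type*} [AddCommGroup G] [AddCommGroup K]
    (φ : G →+ K) {Y : Set G} (h : HasInterpolatingSeq (φ '' Y)) : HasInterpolatingSeq Y := by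
  obtain ⟨z, hz, hε⟩ := h
  choose y hyY hy using hz
  refine ⟨y, hyY, fun ε => ?_⟩
  obtain ⟨χ, hχ⟩ := hε ε
  exact ⟨χ.comp φ, fun n => by simpa [hy] using hχ n⟩

theorem HasInterpolatingSeq.image_of_injective {G K : Type*} [AddCommGroup G] [AddCommGroup K]
    {φ : G →+ K} (hφ : Function.Injective φ) {Y : Set G} (h : HasInterpolatingSeq Y) :
    HasInterpolatingSeq (φ '' Y) := by
  obtain ⟨y, hy, hε⟩ := h
  refine ⟨fun n => φ (y n), fun n => mem_image_of_mem _ (hy n), fun ε => ?_⟩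
  obtain ⟨χ, hχ⟩ := hε ε
  obtain ⟨ψ, hψ⟩ :=
    (Module.Baer.of_divisible UnitAddCircle).extension_property_addMonoidHom φ hφ χ
  refine ⟨ψ, fun n => ?_⟩
  rw [← AddMonoidHom.comp_apply, hψ]
  exact hχ n

theorem exists_addMonoidHom_int_image_infinite {G : Type*} [AddCommGroup G] [AddGroup.FG G]
    {Y : Set G} (hY : Y.Infinite) : ∃ φ : G →+ ℤ, (φ '' Y).Infinite := by
  obtain ⟨n, ι, _, p, hp, e, ⟨f⟩⟩ := AddCommGroup.equiv_free_prod_directSum_zmod G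
  by_contra! h
  have (i : ι) : NeZero (p i ^ e i) := ⟨pow_ne_zero _ (hp i).ne_zero⟩
  let q : Fin n → G →+ ℤ := fun i =>
    (Finsupp.applyAddHom i).comp ((AddMonoidHom.fst _ _).comp f.toAddMonoidHom)
  have hfin : ∀ i, (q i '' Y).Finite := fun i => h (q i)
  let T : G → (Fin n → ℤ) × (∀ i, ZMod (p i ^ e i)) := fun g =>
    (fun i => q i g, fun i => (f g).2 i)
  have hT : Function.Injective T := by
    intro g g' hg
    apply f.injective
    refine Prod.ext ?_ ?_
    · ext i
      exact congrFun (congrArg Prod.fst hg) i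
    · exact DFinsupp.ext fun i => congrFun (congrArg Prod.snd hg) i
  refine hY (Finite.of_finite_image (((Finite.pi' hfin).prod
    (finite_univ (α := ∀ i, ZMod (p i ^ e i)))).subset ?_) hT.injOn)
  rintro _ ⟨g, hg, rfl⟩
  exact ⟨fun i => mem_image_of_mem _ hg, mem_univ _⟩

theorem hasInterpolatingSeq_of_subset_closure {G : Type*} [AddCommGroup G] {Y : Set G}
    (hY : Y.Infinite) (F : Finset G) (hF : Y ⊆ AddSubgroup.closure (F : Set G)) :
    HasInterpolatingSeq Y := by
  let H := AddSubgroup.closure (F : Set G)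
  have : AddGroup.FG H := AddGroup.closure_finset_fg F
  have hYH : H.subtype '' (H.subtype ⁻¹' Y) = Y := by
    rw [image_preimage_eq_inter_range]
    simpa using hF
  have hinf : (H.subtype ⁻¹' Y).Infinite := by
    rw [← hYH] at hY
    exact hY.of_image _
  obtain ⟨φ, hφ⟩ := exists_addMonoidHom_int_image_infinite hinf
  rw [← hYH]
  exact ((hasInterpolatingSeq_int hφ).of_image φ).image_of_injective H.subtype_injective

theorem hasInterpolatingSeq_of_two_zsmul_eq_zero {G : Type*} [AddCommGroup G] {Y : Set G}
    (hY : Y.Infinite) (h2 : ∀ y ∈ Y, (2 : ℤ) • y = 0) : HasInterpolatingSeq Y := by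
  by_cases h : ∃ F : Finset G, Y ⊆ AddSubgroup.closure (F : Set G)
  · obtain ⟨F, hF⟩ := h
    exact hasInterpolatingSeq_of_subset_closure hY F hF
  · push Not at h
    refine hasInterpolatingSeq_of_forall_finset fun F _ => ?_
    obtain ⟨x, hxY, hx⟩ := not_subset.1 (h F)
    obtain ⟨ψ, hψ, hψx⟩ := exists_unitAddCircle_character_ne_zero _ hx
    refine ⟨x, hxY, fun χ j => ?_⟩
    obtain ⟨n, hn⟩ := exists_add_zsmul_mem_bohrArc_of_two_zsmul hψx
      (by rw [← map_zsmul, h2 x hxY, map_zero]) (c := χ x)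
      (by rw [← map_zsmul, h2 x hxY, map_zero]) j
    exact ⟨χ + n • ψ, fun y hy => by simp [hψ y (AddSubgroup.subset_closure hy)], hn⟩

theorem exists_hasInterpolatingSeq_image_sub {G : Type*} [AddCommGroup G] {X : Set G}
    (hX : X.Infinite) : ∃ a : G, HasInterpolatingSeq ((fun x => x - a) '' X) := by
  by_cases h : ∀ F : Finset G, ∃ x ∈ X, (2 : ℤ) • x ∉ AddSubgroup.closure (F : Set G)
  · refine ⟨0, ?_⟩
    simp only [sub_zero, image_id']
    refine hasInterpolatingSeq_of_forall_finset fun F _ => ?_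
    obtain ⟨x, hxX, hx⟩ := h F
    obtain ⟨ψ, hψ, hψx⟩ := exists_unitAddCircle_character_ne_zero _ hx
    rw [map_zsmul] at hψx
    refine ⟨x, hxX, fun χ j => ?_⟩
    obtain ⟨n, hn⟩ := exists_add_zsmul_mem_bohrArc hψx (χ x) j
    exact ⟨χ + n • ψ, fun y hy => by simp [hψ y (AddSubgroup.subset_closure hy)], hn⟩
  · push Not at h
    obtain ⟨F, hF⟩ := h
    rcases (zsmulAddGroupHom (α := G) 2 '' X).finite_or_infinite with hfin | hinf
    · have hfib : ∃ b, (X ∩ zsmulAddGroupHom (α := G) 2 ⁻¹' {b}).Infinite := by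
        by_contra! h
        exact hX (Finite.of_finite_fibers _ hfin fun b _ => h b)
      obtain ⟨b, hb⟩ := hfib
      obtain ⟨a, -, ha⟩ := hb.nonempty
      obtain ⟨y, hy, hε⟩ := hasInterpolatingSeq_of_two_zsmul_eq_zero
        (hb.image (sub_left_injective (b := a)).injOn) (by
          rintro _ ⟨x, ⟨-, hx⟩, rfl⟩
          simp only [mem_preimage, mem_singleton_iff, zsmulAddGroupHom_apply] at hx ha
          rw [zsmul_sub, hx, ha, sub_self])
      exact ⟨a, y, fun n => image_mono inter_subset_left (hy n), hε⟩
    · refine ⟨0, ?_⟩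
      simp only [sub_zero, image_id']
      refine HasInterpolatingSeq.of_image (zsmulAddGroupHom 2)
        (hasInterpolatingSeq_of_subset_closure hinf F ?_)
      rintro _ ⟨x, hx, rfl⟩
      exact hF x hx

theorem exists_mem_closure_bohrEval_forall_mem {G : Type*} [AddCommGroup G] {X : Set G} {a : G}
    (h : HasInterpolatingSeq ((fun x => x - a) '' X)) :
    ∃ χ : (ℕ → Bool) → G →+ UnitAddCircle, ∀ S : (ℕ → Bool) → Bool,
      ∃ p ∈ closure (bohrEval G '' X), ∀ f, p (χ f) - χ f a ∈ bohrArc (S f) := by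
  classical
  obtain ⟨y, hy, hε⟩ := h
  choose x hxX hx using hy
  let D := Σ n : ℕ, ((Fin n → Bool) → Bool)
  let ε : (ℕ → Bool) → ℕ → Bool := fun f m =>
    match (Encodable.decode m : Option D) with
    | some d => d.2 fun i => f i
    | none => false
  have hεd (f : ℕ → Bool) (d : D) : ε f (Encodable.encode d) = d.2 fun i => f i := by
    simp [ε, Encodable.encodek]
  choose χ hχ using fun f => hε (ε f)
  refine ⟨χ, fun S => ?_⟩
  let t : (ℕ → Bool) → Set ((G →+ UnitAddCircle) → UnitAddCircle) :=
    fun f => {p | p (χ f) - χ f a ∈ bohrArc (S f)}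
  have ht : ∀ u : Finset (ℕ → Bool), (closure (bohrEval G '' X) ∩ ⋂ f ∈ u, t f).Nonempty := by
    intro u
    obtain ⟨n, hn⟩ : ∃ n : ℕ, ∀ f ∈ u, ∀ g ∈ u, (∀ i : Fin n, f i = g i) → f = g := by
      have : ∀ q : (ℕ → Bool) × (ℕ → Bool), ∃ m : ℕ, q.1 ≠ q.2 → q.1 m ≠ q.2 m := by
        intro q
        by_cases hq : q.1 = q.2
        · exact ⟨0, fun h => absurd hq h⟩
        · obtain ⟨m, hm⟩ := Function.ne_iff.1 hq
          exact ⟨m, fun _ => hm⟩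
      choose m hm using this
      refine ⟨(u ×ˢ u).sup m + 1, fun f hf g hg hfg => ?_⟩
      by_contra hne
      exact hm (f, g) hne (hfg ⟨m (f, g), Nat.lt_succ_of_le
        (Finset.le_sup (f := m) (Finset.mk_mem_product hf hg))⟩)
    let d : D := ⟨n, fun t => decide (∃ f ∈ u, (∀ i : Fin n, f i = t i) ∧ S f = true)⟩
    have hd : ∀ f ∈ u, (d.2 fun i => f i) = S f := by
      intro f hf
      rw [Bool.eq_iff_iff, decide_eq_true_iff]
      constructor
      · rintro ⟨g, hg, hgf, hS⟩
        rwa [← hn g hg f hf hgf]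
      · exact fun hS => ⟨f, hf, fun _ => rfl, hS⟩
    refine ⟨bohrEval G (x (Encodable.encode d)),
      subset_closure (mem_image_of_mem _ (hxX _)), ?_⟩
    refine mem_iInter₂.2 fun f hf => ?_
    have := hχ f (Encodable.encode d)
    rw [← hx, hεd, hd f hf, map_sub] at this
    exact this
  obtain ⟨p, hp, hpS⟩ := isClosed_closure.isCompact.inter_iInter_nonempty t
    (fun f => (isClosed_bohrArc (S f)).preimage (by fun_prop)) ht
  exact ⟨p, hp, fun f => mem_iInter.1 hpS f⟩

end

/-- Van Douwen's theorem: for an infinite subset `X` of an abelian group `G`, the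
closure of `X` in the Bohr compactification `bG` has cardinality at least `2^𝔠`. -/
theorem stmt17 {G : Type*} [AddCommGroup G] (X : Set G) (hX : X.Infinite) :
    (2 : Cardinal) ^ Cardinal.continuum ≤ Cardinal.mk (closure (bohrEval G '' X)) := by
  obtain ⟨a, ha⟩ := exists_hasInterpolatingSeq_image_sub hX
  obtain ⟨χ, hχ⟩ := exists_mem_closure_bohrEval_forall_mem ha
  choose p hp hpS using hχ
  have hinj : Function.Injective
      (fun S => ⟨p S, hp S⟩ : ((ℕ → Bool) → Bool) → closure (bohrEval G '' X)) := by
    intro S S' h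
    funext f
    have h' : p S = p S' := congrArg Subtype.val h
    have := hpS S f
    rw [h'] at this
    exact eq_of_mem_bohrArc this (hpS S' f)
  have := Cardinal.lift_mk_le_lift_mk_of_injective hinj
  simpa using this
end
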